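/- Let N_max ≥ 1 be an integer and let A_1, …, A_5 : {1,…,N_max} → ℝ, with p_1,…,p_5 ≥ 0, ∑_{i=1}^5 p_i = 1. Write Δ_i(N_1,N_2) = A_i(N_2) − A_i(N_1) and A_𝒟(N) = ∑_{i=1}^5 p_i A_i(N). Let N* ∈ {1,…,N_max} and assume: (i) Δ_1(N,N*) = Δ_2(N,N*) = Δ_5(N,N*) = 0 for all N ≤ N*; (ii) −Δ_3(N,N*) > 0 and Δ_4(N,N*) > 0 for all N < N*. Define δ = inf_{1 ≤ N < N*} Δ_4(N,N*) / (−Δ_3(N,N*)) and assume δ > 0. Let N_𝒟 = min(argmax_{N ∈ {1,…,N_max}} A_𝒟(N)). Then N_𝒟 ≥ 1 + (N* − 1)·𝟙{ p_4 δ > 1 − p_4 }; in particular, if p_4 δ > 1 − p_4 then N_𝒟 ≥ N*. -/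

import Mathlib

/-- Lower bound on the system-optimal parallelism level: under the five-type structure,
`N_𝒟 ≥ 1 + (N* − 1)·𝟙{p₄δ > 1 − p₄}`; in particular if `p₄δ > 1 − p₄` then `N_𝒟 ≥ N*`. -/
theorem stmt4 (Nmax : ℕ) (hNmax : 1 ≤ Nmax)
    (A1 A2 A3 A4 A5 : ℕ → ℝ) (p1 p2 p3 p4 p5 : ℝ)
    (hp1 : 0 ≤ p1) (hp2 : 0 ≤ p2) (hp3 : 0 ≤ p3) (hp4 : 0 ≤ p4) (hp5 : 0 ≤ p5)
    (hpsum : p1 + p2 + p3 + p4 + p5 = 1)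
    (AD : ℕ → ℝ)
    (hAD : ∀ N, AD N = p1 * A1 N + p2 * A2 N + p3 * A3 N + p4 * A4 N + p5 * A5 N)
    (Nstar : ℕ) (hNstar1 : 1 ≤ Nstar) (hNstar2 : Nstar ≤ Nmax)
    (h1 : ∀ N, 1 ≤ N → N ≤ Nstar → A1 Nstar - A1 N = 0)
    (h2 : ∀ N, 1 ≤ N → N ≤ Nstar → A2 Nstar - A2 N = 0)
    (h5 : ∀ N, 1 ≤ N → N ≤ Nstar → A5 Nstar - A5 N = 0)
    (h3 : ∀ N, 1 ≤ N → N < Nstar → 0 < -(A3 Nstar - A3 N))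
    (h4 : ∀ N, 1 ≤ N → N < Nstar → 0 < A4 Nstar - A4 N)
    (δ : ℝ)
    (hδ : δ = sInf ((fun N => (A4 Nstar - A4 N) / (-(A3 Nstar - A3 N))) ''
        {N : ℕ | 1 ≤ N ∧ N < Nstar}))
    (hδpos : 0 < δ)
    (ND : ℕ) (hND1 : 1 ≤ ND) (hND2 : ND ≤ Nmax)
    (hNDmax : ∀ N, 1 ≤ N → N ≤ Nmax → AD N ≤ AD ND)
    (hNDmin : ∀ N, 1 ≤ N → N ≤ Nmax → AD N = AD ND → ND ≤ N) :
    (1 + ((Nstar : ℝ) - 1) * (if p4 * δ > 1 - p4 then (1 : ℝ) else 0) ≤ (ND : ℝ)) ∧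
    (p4 * δ > 1 - p4 → Nstar ≤ ND) := by
  have key : p4 * δ > 1 - p4 → Nstar ≤ ND := by
    intro hp
    by_contra! hlt
    have d3 := h3 ND hND1 hlt
    have hle : δ ≤ (A4 Nstar - A4 ND) / (-(A3 Nstar - A3 ND)) := by
      rw [hδ]
      refine csInf_le ⟨0, ?_⟩ ⟨ND, ⟨hND1, hlt⟩, rfl⟩
      rintro _ ⟨N, ⟨hN1, hN2⟩, rfl⟩
      exact (div_pos (h4 N hN1 hN2) (h3 N hN1 hN2)).le
    rw [le_div_iff₀ d3] at hle
    have hgain := mul_le_mul_of_nonneg_left hle hp4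
    have hloss : p3 * -(A3 Nstar - A3 ND) < p4 * δ * -(A3 Nstar - A3 ND) :=
      mul_lt_mul_of_pos_right (by linarith) d3
    have hopt := hNDmax Nstar hNstar1 hNstar2
    rw [hAD, hAD, sub_eq_zero.mp (h1 ND hND1 hlt.le), sub_eq_zero.mp (h2 ND hND1 hlt.le),
      sub_eq_zero.mp (h5 ND hND1 hlt.le)] at hopt
    linarith
  refine ⟨?_, key⟩
  split_ifs with hp
  · have : (Nstar : ℝ) ≤ ND := by exact_mod_cast key hp
    linarith
  · simpa using hND1
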